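/- arXiv:2102.13339 — 2 statements merged into one kernel-verified Lean document; each statement's English description precedes it below -/
import Mathlib

section
/- Let 1 ≤ k ≤ n and let θ = (θ_1, …, θ_n) ∈ ℝⁿ be generic and f_{k,n}-admissible. Define the top-cell boundary measurement curve γ_θ : ℝ → ℝⁿ by (γ_θ(t))_r = Π_{j=1}^{k−1} sin(t − θ̃_{r+j}) for r ∈ [n]. Then: (i) the ℝ-linear span of {γ_θ(t) : t ∈ ℝ} has dimension exactly k; (ii) for any real numbers 0 ≤ s_1 < s_2 < … < s_k < π, the vectors γ_θ(s_1), …, γ_θ(s_k) form a basis of this span, and the ratio of any two nonzero k×k minors of the k×n matrix whose rows are γ_θ(s_1), …, γ_θ(s_k) is positive (so the span is a point of the totally nonnegative Grassmannian Gr_{≥0}(k,n)). (This is the boundary measurement formula, Theorem 1.9, specialized to the top cell f = f_{k,n}, combined with Proposition 4.4.) -/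
noncomputable def tcVand {k : ℕ} (s : Fin k → ℝ) : ℝ :=
  ∏ i : Fin k, ∏ j ∈ Finset.Ioi i, Real.sin (s j - s i)

noncomputable def tcMon (d : ℕ) (l : Fin (d + 1)) : ℝ → ℝ :=
  fun t => Real.sin t ^ (l : ℕ) * Real.cos t ^ (d - (l : ℕ))

def tcForm (d : ℕ) : Submodule ℝ (ℝ → ℝ) := Submodule.span ℝ (Set.range (tcMon d))

theorem tc_mon_det (d : ℕ) (s : Fin (d + 1) → ℝ) :
    (Matrix.of fun j i => tcMon d i (s j)).det = tcVand s := by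
  have h : (Matrix.of fun j i => tcMon d i (s j)) =
      Matrix.projVandermonde (fun j => Real.sin (s j)) (fun j => Real.cos (s j)) := by
    ext j i
    simp only [Matrix.of_apply, tcMon, Matrix.projVandermonde_apply]
    congr 2
    simp [Fin.val_rev]
  rw [h, Matrix.det_projVandermonde]
  unfold tcVand
  refine Finset.prod_congr rfl fun i _ => Finset.prod_congr rfl fun j _ => ?_
  rw [Real.sin_sub]; ring

theorem tc_form_det (d : ℕ) (f : Fin (d + 1) → ℝ → ℝ) (hf : ∀ i, f i ∈ tcForm d) :
    ∃ L : ℝ, ∀ s : Fin (d + 1) → ℝ,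
      (Matrix.of fun j i => f i (s j)).det = L * tcVand s := by
  have h : ∀ i, ∃ a : Fin (d + 1) → ℝ, ∑ l, a l • tcMon d l = f i := fun i =>
    (Submodule.mem_span_range_iff_exists_fun ℝ).1 (hf i)
  choose a ha using h
  refine ⟨(Matrix.of fun l i => a i l).det, fun s => ?_⟩
  rw [← tc_mon_det, mul_comm, ← Matrix.det_mul]
  congr 1
  ext j i
  rw [Matrix.mul_apply]
  simp only [Matrix.of_apply]
  rw [← ha i]
  simp [Finset.sum_apply, mul_comm]

theorem tc_form_mul (d : ℕ) (f : ℝ → ℝ) (hf : f ∈ tcForm d) (A B : ℝ) :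
    (fun t => (A * Real.sin t + B * Real.cos t) * f t) ∈ tcForm (d + 1) := by
  unfold tcForm at hf
  induction hf using Submodule.span_induction with
  | mem x hx =>
    obtain ⟨l, rfl⟩ := hx
    have h : (fun t => (A * Real.sin t + B * Real.cos t) * tcMon d l t) =
        A • tcMon (d + 1) l.succ + B • tcMon (d + 1) l.castSucc := by
      ext t
      have : d + 1 - (l : ℕ) = (d - l) + 1 := by omega
      simp [tcMon, this]
      ring
    rw [h]
    exact Submodule.add_mem _ (Submodule.smul_mem _ _ (Submodule.subset_span ⟨_, rfl⟩))
      (Submodule.smul_mem _ _ (Submodule.subset_span ⟨_, rfl⟩))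
  | zero =>
    have : (fun t => (A * Real.sin t + B * Real.cos t) * (0 : ℝ → ℝ) t) = 0 := by
      ext t; simp
    rw [this]; exact Submodule.zero_mem _
  | add x y _ _ hx hy =>
    have : (fun t => (A * Real.sin t + B * Real.cos t) * (x + y) t) =
      (fun t => (A * Real.sin t + B * Real.cos t) * x t) +
      (fun t => (A * Real.sin t + B * Real.cos t) * y t) := by
      ext t; simp; ring
    rw [this]; exact Submodule.add_mem _ hx hy
  | smul c x _ hx =>
    have : (fun t => (A * Real.sin t + B * Real.cos t) * (c • x) t) =
      c • (fun t => (A * Real.sin t + B * Real.cos t) * x t) := by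
      ext t; simp; ring
    rw [this]; exact Submodule.smul_mem _ _ hx

theorem tc_form_mul_sin (d : ℕ) (f : ℝ → ℝ) (hf : f ∈ tcForm d) (c : ℝ) :
    (fun t => Real.sin (t - c) * f t) ∈ tcForm (d + 1) := by
  have := tc_form_mul d f hf (Real.cos c) (- Real.sin c)
  convert this using 3
  rw [Real.sin_sub]; ring

noncomputable def tcQ (θ : ℕ → ℝ) (d r : ℕ) : ℝ → ℝ :=
  fun t => ∏ j ∈ Finset.range d, Real.sin (θ (r + 1 + j) - t)

theorem tc_Q_form (θ : ℕ → ℝ) (d r : ℕ) : tcQ θ d r ∈ tcForm d := by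
  induction d with
  | zero =>
    apply Submodule.subset_span
    refine ⟨0, ?_⟩
    ext t; simp [tcMon, tcQ]
  | succ d ih =>
    have := tc_form_mul d _ ih (- Real.cos (θ (r + 1 + d))) (Real.sin (θ (r + 1 + d)))
    convert this using 1
    ext t
    simp only [tcQ, Finset.prod_range_succ]
    rw [Real.sin_sub]; ring

theorem tc_vand_cons {k : ℕ} (c : ℝ) (s : Fin k → ℝ) :
    tcVand (Fin.cons c s : Fin (k + 1) → ℝ) = (∏ j, Real.sin (s j - c)) * tcVand s := by
  unfold tcVand
  rw [Fin.prod_univ_succ]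
  congr 1
  · rw [Fin.prod_Ioi_zero]; simp
  · refine Finset.prod_congr rfl fun i _ => ?_
    rw [Fin.prod_Ioi_succ]; simp

theorem tc_det_cons {k : ℕ} (c : ℝ) (s : Fin k → ℝ) (w S : ℝ → ℝ) (hS : S c = 0)
    (u : Fin k → ℝ → ℝ) :
    (Matrix.of fun j i => (Fin.cons w (fun i t => S t * u i t) : Fin (k + 1) → ℝ → ℝ) i
      ((Fin.cons c s : Fin (k + 1) → ℝ) j)).det =
      w c * ((∏ j, S (s j)) * (Matrix.of fun j i => u i (s j)).det) := by
  rw [Matrix.det_succ_row_zero, Fin.sum_univ_succ, Finset.sum_eq_zero]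
  · rw [← Matrix.det_mul_column]
    simp only [Matrix.of_apply, Fin.cons_zero, Fin.val_zero, pow_zero, one_mul, add_zero]
    congr 2
  · intro i _
    simp [hS]

theorem tc_exists_s (k : ℕ) (c : ℝ) : ∃ s : Fin k → ℝ, tcVand (Fin.cons c s : Fin (k + 1) → ℝ) ≠ 0 := by
  refine ⟨fun j => c + ((j : ℝ) + 1) * (Real.pi / (k + 1)), ?_⟩
  have hk : (0 : ℝ) < k + 1 := by positivity
  have h : (Fin.cons c (fun j : Fin k => c + ((j : ℝ) + 1) * (Real.pi / (k + 1))) : Fin (k + 1) → ℝ)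
      = fun j : Fin (k + 1) => c + (j : ℝ) * (Real.pi / (k + 1)) := by
    ext j
    refine Fin.cases ?_ (fun j => ?_) j <;> simp
  rw [h]
  unfold tcVand
  refine Finset.prod_ne_zero_iff.2 fun i _ => Finset.prod_ne_zero_iff.2 fun j hj => ?_
  have hij : (i : ℝ) < j := by exact_mod_cast (Finset.mem_Ioi.1 hj)
  have hj2 : (j : ℝ) < k + 1 := by exact_mod_cast j.2
  have hi0 : (0 : ℝ) ≤ i := by positivity
  apply ne_of_gt
  apply Real.sin_pos_of_pos_of_lt_pi
  · have : 0 < ((j : ℝ) - i) * (Real.pi / (k + 1)) :=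
      mul_pos (by linarith) (div_pos Real.pi_pos hk)
    linarith
  · have : ((j : ℝ) - i) * (Real.pi / (k + 1)) < (k + 1) * (Real.pi / (k + 1)) :=
      mul_lt_mul_of_pos_right (by linarith) (div_pos Real.pi_pos hk)
    rw [mul_div_cancel₀ _ hk.ne'] at this
    linarith

def tcTNN (k N : ℕ) (f : ℕ → ℝ → ℝ) : Prop :=
  ∀ g : Fin k → ℕ, StrictMono g → (∀ i, g i < N) → ∀ s : Fin k → ℝ,
    0 ≤ (Matrix.of fun j i => f (g i) (s j)).det * tcVand s

theorem tc_TNN_lift (d N : ℕ) (c : ℝ) (w : ℝ → ℝ) (hw : w ∈ tcForm (d + 1)) (hc : 0 ≤ w c)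
    (u : ℕ → ℝ → ℝ) (hu : ∀ i, u i ∈ tcForm d) (h : tcTNN (d + 1) N u)
    (f : ℕ → ℝ → ℝ) (hf0 : f 0 = w)
    (hf1 : ∀ i, f (i + 1) = fun t => Real.sin (t - c) * u i t) :
    tcTNN (d + 2) (N + 1) f := by
  intro g hg hgN s
  have hform : ∀ i, f i ∈ tcForm (d + 1) := by
    intro i
    cases i with
    | zero => rw [hf0]; exact hw
    | succ i => rw [hf1]; exact tc_form_mul_sin d _ (hu i) c
  obtain ⟨L, hL⟩ := tc_form_det (d + 1) (fun i => f (g i)) (fun i => hform _)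
  suffices hL0 : 0 ≤ L by
    rw [hL, mul_assoc]
    exact mul_nonneg hL0 (mul_self_nonneg _)
  obtain ⟨s', hs'⟩ := tc_exists_s (d + 1) c
  have hpos : ∀ i : Fin (d + 1), 0 < g i.succ := fun i =>
    lt_of_le_of_lt (Nat.zero_le _) (hg (Fin.succ_pos i))
  have hE : (fun i => f (g i)) =
      (Fin.cons (f (g 0)) (fun i t => Real.sin (t - c) * u (g i.succ - 1) t) :
        Fin (d + 2) → ℝ → ℝ) := by
    ext i t
    refine Fin.cases ?_ (fun i => ?_) i
    · simp
    · obtain ⟨m, hm⟩ : ∃ m, g i.succ = m + 1 := ⟨g i.succ - 1, by have := hpos i; omega⟩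
      simp [hm, hf1]
  have hdet := hL (Fin.cons c s')
  have h2 := tc_det_cons c s' (f (g 0)) (fun t => Real.sin (t - c)) (by simp)
    (fun i => u (g i.succ - 1))
  rw [← hE] at h2
  rw [hdet] at h2
  have h3 := h (fun i => g i.succ - 1)
    (fun i j hij => by
      have := hg (Fin.succ_lt_succ_iff.2 hij)
      have := hpos i
      show g i.succ - 1 < g j.succ - 1
      omega)
    (fun i => by have := hgN i.succ; have := hpos i; show g i.succ - 1 < N; omega) s'
  have hw0 : 0 ≤ f (g 0) c := by
    cases hg0 : g 0 with
    | zero => rw [hf0]; exact hc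
    | succ m => rw [hf1]; simp
  have h4 : 0 ≤ L * (tcVand (Fin.cons c s' : Fin (d + 2) → ℝ) * tcVand (Fin.cons c s' : Fin (d + 2) → ℝ)) := by
    rw [← mul_assoc, h2, tc_vand_cons]
    have : ∀ (a P D V : ℝ), a * (P * D) * (P * V) = a * (P * P * (D * V)) := by intros; ring
    rw [this]
    exact mul_nonneg hw0 (mul_nonneg (mul_self_nonneg _) h3)
  exact nonneg_of_mul_nonneg_left h4 (mul_self_pos.2 hs')

theorem tc_TNN_step (k N m : ℕ) (f f' : ℕ → ℝ → ℝ) (a b : ℝ) (ha : 0 ≤ a) (hb : 0 ≤ b)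
    (h : tcTNN k N f) (hm : ∀ t, f' (m + 1) t = a * f m t + b * f (m + 1) t)
    (hne : ∀ i, i ≠ m + 1 → f' i = f i) : tcTNN k N f' := by
  intro g hg hgN s
  by_cases hmem : ∃ i0, g i0 = m + 1
  · obtain ⟨i0, hi0⟩ := hmem
    have hother : ∀ i, i ≠ i0 → g i ≠ m + 1 := fun i hi he =>
      hi (hg.injective (he.trans hi0.symm))
    have hM : (Matrix.of fun j i => f' (g i) (s j)) =
        (Matrix.of fun j i => f (g i) (s j)).updateCol i0
          (a • (fun j => f m (s j)) + b • (fun j => f (m + 1) (s j))) := by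
      ext j i
      by_cases hi : i = i0
      · subst hi; simp [hi0, hm]
      · rw [Matrix.updateCol_ne hi]; simp [hne _ (hother i hi)]
    have hM2 : (Matrix.of fun j i => f (g i) (s j)).updateCol i0 (fun j => f (m + 1) (s j)) =
        (Matrix.of fun j i => f (g i) (s j)) := by
      ext j i
      by_cases hi : i = i0
      · subst hi; simp [hi0]
      · rw [Matrix.updateCol_ne hi]
    have hM3 : (Matrix.of fun j i => f (g i) (s j)).updateCol i0 (fun j => f m (s j)) =
        (Matrix.of fun j i => f (Function.update g i0 m i) (s j)) := by
      ext j i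
      by_cases hi : i = i0
      · subst hi; simp
      · rw [Matrix.updateCol_ne hi]; simp [hi]
    have hnn : 0 ≤ (Matrix.of fun j i => f (Function.update g i0 m i) (s j)).det * tcVand s := by
      by_cases hmm : ∃ i1, g i1 = m
      · obtain ⟨i1, hi1⟩ := hmm
        have hne1 : i1 ≠ i0 := by rintro rfl; omega
        rw [Matrix.det_zero_of_column_eq hne1, zero_mul]
        intro j
        simp [hne1, hi1]
      · push Not at hmm
        apply h
        · intro i j hij
          have hgij := hg hij
          by_cases h1 : i = i0
          · subst h1
            have : j ≠ i := hij.ne'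
            simp [this]; omega
          · by_cases h2 : j = i0
            · subst h2
              have := hmm i
              simp [h1]; omega
            · simp [h1, h2, hgij]
        · intro i
          by_cases h1 : i = i0
          · subst h1
            have := hgN i
            simp; omega
          · simp [h1, hgN]
    rw [hM, Matrix.det_updateCol_add, Matrix.det_updateCol_smul, Matrix.det_updateCol_smul, hM2, hM3]
    have := h g hg hgN s
    rw [add_mul, mul_assoc, mul_assoc]
    exact add_nonneg (mul_nonneg ha hnn) (mul_nonneg hb this)
  · push Not at hmem
    have := h g hg hgN s
    simpa only [hne _ (hmem _)] using this

theorem tc_prod_remove (F : ℕ → ℝ) (d e : ℕ) (he : e ≤ d) :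
    ∏ j ∈ Finset.range (d + 1), F j =
      F e * ∏ j ∈ Finset.range d, (if j < e then F j else F (j + 1)) := by
  induction d with
  | zero =>
    obtain rfl : e = 0 := by omega
    simp
  | succ d ih =>
    rcases Nat.lt_or_ge d e with h | h
    · obtain rfl : e = d + 1 := by omega
      rw [Finset.prod_range_succ, mul_comm]
      congr 1
      refine Finset.prod_congr rfl fun j hj => ?_
      rw [if_pos (Finset.mem_range.1 hj)]
    · rw [Finset.prod_range_succ, ih h, Finset.prod_range_succ _ d, if_neg (by omega)]
      ring

theorem tc_TNN_zero (θ : ℕ → ℝ) (N : ℕ) : tcTNN 1 N (tcQ θ 0) := by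
  intro g hg hgN s
  simp [tcQ, tcVand]

theorem tc_TNN_main (d : ℕ) : ∀ (N : ℕ) (θ : ℕ → ℝ), d + 1 ≤ N → StrictMono θ →
    (∀ p, θ (p + N) = θ p + Real.pi) → tcTNN (d + 1) N (tcQ θ d) := by
  induction d with
  | zero => intro N θ _ _ _; exact tc_TNN_zero θ N
  | succ d ih =>
    intro N θ hN hθ hper
    obtain ⟨M, rfl⟩ : ∃ M, N = M + 1 := ⟨N - 1, by omega⟩
    have hM : d + 1 ≤ M := by omega
    have hM0 : 0 < M := by omega
    let θ' : ℕ → ℝ := fun p => θ (p + 1 + p / M)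
    have hθ' : StrictMono θ' := by
      intro p q hpq
      have := Nat.div_le_div_right (c := M) hpq.le
      exact hθ (by omega)
    have hper' : ∀ p, θ' (p + M) = θ' p + Real.pi := by
      intro p
      show θ (p + M + 1 + (p + M) / M) = θ (p + 1 + p / M) + Real.pi
      rw [Nat.add_div_right _ hM0, ← hper]
      congr 1; omega
    have IH := ih M θ' hM hθ' hper'
    have hrange : ∀ i, 1 ≤ i → i ≤ M → 0 < Real.sin (θ i - θ 0) := by
      intro i h1 h2
      apply Real.sin_pos_of_pos_of_lt_pi
      · have := hθ (show 0 < i by omega); linarith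
      · have := hθ (show i < 0 + (M + 1) by omega)
        rw [hper] at this; linarith
    have hB : ∀ r, M ≤ r + 1 + d → r < M → tcQ θ (d + 1) (r + 1) =
        fun t => Real.sin (t - θ 0) * tcQ θ' d r t := by
      intro r h1 h2
      ext t
      unfold tcQ
      rw [tc_prod_remove _ d (M - 1 - r) (by omega)]
      congr 1
      · have : r + 1 + 1 + (M - 1 - r) = 0 + (M + 1) := by omega
        rw [this, hper, ← Real.sin_pi_sub]
        congr 1; ring
      · refine Finset.prod_congr rfl fun j hj => ?_
        have hj := Finset.mem_range.1 hj
        show _ = Real.sin (θ (r + 1 + j + 1 + (r + 1 + j) / M) - t)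
        split_ifs with hje
        · rw [Nat.div_eq_of_lt (by omega)]
          congr 3; omega
        · have : (r + 1 + j) / M = 1 := by
            rw [Nat.div_eq_iff hM0]; omega
          rw [this]
          congr 3; omega
    have hA : ∀ r, r + d + 2 ≤ M → ∀ t, tcQ θ (d + 1) (r + 1) t =
        Real.sin (θ (r + d + 2) - θ 0) / Real.sin (θ (r + 1) - θ 0) * tcQ θ (d + 1) r t +
        Real.sin (θ (r + d + 2) - θ (r + 1)) / Real.sin (θ (r + 1) - θ 0) *
          (Real.sin (t - θ 0) * tcQ θ' d r t) := by
      intro r hr t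
      have e1 : tcQ θ (d + 1) (r + 1) t = Real.sin (θ (r + d + 2) - t) * tcQ θ' d r t := by
        unfold tcQ
        rw [tc_prod_remove _ d d le_rfl]
        congr 1
        · congr 3; omega
        · refine Finset.prod_congr rfl fun j hj => ?_
          have hj := Finset.mem_range.1 hj
          show _ = Real.sin (θ (r + 1 + j + 1 + (r + 1 + j) / M) - t)
          rw [if_pos hj, Nat.div_eq_of_lt (by omega)]
          congr 3; omega
      have e2 : tcQ θ (d + 1) r t = Real.sin (θ (r + 1) - t) * tcQ θ' d r t := by
        unfold tcQ
        rw [tc_prod_remove _ d 0 (Nat.zero_le _)]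
        congr 1
        refine Finset.prod_congr rfl fun j hj => ?_
        have hj := Finset.mem_range.1 hj
        show _ = Real.sin (θ (r + 1 + j + 1 + (r + 1 + j) / M) - t)
        rw [if_neg (by omega), Nat.div_eq_of_lt (by omega)]
        congr 3
      rw [e1, e2]
      have hne := (hrange (r + 1) (by omega) (by omega)).ne'
      have key : Real.sin (θ (r + 1) - θ 0) * Real.sin (θ (r + d + 2) - t) =
          Real.sin (θ (r + d + 2) - θ 0) * Real.sin (θ (r + 1) - t) +
          Real.sin (θ (r + d + 2) - θ (r + 1)) * Real.sin (t - θ 0) := by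
        generalize θ (r + 1) = a
        generalize θ (r + d + 2) = b
        generalize θ 0 = c
        simp only [Real.sin_sub]
        have ht := Real.sin_sq_add_cos_sq t
        ring
      field_simp
      linear_combination tcQ θ' d r t * key
    let F : ℕ → ℕ → ℝ → ℝ := fun m i =>
      if i ≤ m then tcQ θ (d + 1) i else fun t => Real.sin (t - θ 0) * tcQ θ' d (i - 1) t
    have hF : ∀ m, m + d + 1 ≤ M → tcTNN (d + 2) (M + 1) (F m) := by
      intro m
      induction m with
      | zero =>
        intro _
        refine tc_TNN_lift d M (θ 0) (tcQ θ (d + 1) 0) (tc_Q_form _ _ _) ?_ (tcQ θ' d)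
          (fun i => tc_Q_form _ _ _) IH (F 0) ?_ ?_
        · unfold tcQ
          refine Finset.prod_nonneg fun j hj => ?_
          have hj := Finset.mem_range.1 hj
          exact (hrange _ (by omega) (by omega)).le
        · simp [F]
        · intro i; simp [F]
      | succ m ihm =>
        intro hm
        have p1 := hrange (m + 1) (by omega) (by omega)
        refine tc_TNN_step (d + 2) (M + 1) m (F m) (F (m + 1))
          (Real.sin (θ (m + d + 2) - θ 0) / Real.sin (θ (m + 1) - θ 0))
          (Real.sin (θ (m + d + 2) - θ (m + 1)) / Real.sin (θ (m + 1) - θ 0))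
          ?_ ?_ (ihm (by omega)) ?_ ?_
        · exact div_nonneg (hrange _ (by omega) (by omega)).le p1.le
        · refine div_nonneg (le_of_lt (Real.sin_pos_of_pos_of_lt_pi ?_ ?_)) p1.le
          · have := hθ (show m + 1 < m + d + 2 by omega); linarith
          · have := hθ (show m + d + 2 < m + 1 + (M + 1) by omega)
            rw [hper] at this; linarith
        · intro t
          simp only [F, le_refl, if_true]
          rw [if_neg (by omega)]
          simpa using hA m (by omega) t
        · intro i hi
          simp only [F]
          by_cases h1 : i ≤ m
          · rw [if_pos h1, if_pos (by omega)]
          · rw [if_neg h1, if_neg (by omega)]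
    have hfin := hF (M - 1 - d) (by omega)
    intro g hg hgN s
    have h5 := hfin g hg hgN s
    have h6 : ∀ i, F (M - 1 - d) (g i) = tcQ θ (d + 1) (g i) := by
      intro i
      simp only [F]
      split_ifs with hi
      · rfl
      · have := hgN i
        rw [← hB (g i - 1) (by omega) (by omega)]
        congr 1; omega
    simpa only [h6] using h5

theorem tc_det_ne_zero (d : ℕ) : ∀ (θ : ℕ → ℝ),
    (∀ a b, a < b → b ≤ a + d → Real.sin (θ b - θ a) ≠ 0) →
    ∀ s : Fin (d + 1) → ℝ, tcVand s ≠ 0 →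
    (Matrix.of fun j (i : Fin (d + 1)) => tcQ θ d i (s j)).det ≠ 0 := by
  induction d with
  | zero => intro θ _ s _; simp [tcQ]
  | succ d ih =>
    intro θ hθ s hs
    let θ' : ℕ → ℝ := fun i => if i < d + 1 then θ (i + 1) else θ (i + 2)
    have IH := ih θ' (by
      intro a b hab hb
      simp only [θ']
      split_ifs
      · exact hθ _ _ (by omega) (by omega)
      · omega
      · exact hθ _ _ (by omega) (by omega)
      · exact hθ _ _ (by omega) (by omega))
    obtain ⟨L, hL⟩ := tc_form_det (d + 1) (fun i => tcQ θ (d + 1) i) (fun i => tc_Q_form _ _ _)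
    rw [hL]
    refine mul_ne_zero ?_ hs
    obtain ⟨s', hs'⟩ := tc_exists_s (d + 1) (θ (d + 2))
    have hE : (fun i : Fin (d + 2) => tcQ θ (d + 1) i) =
        (Fin.cons (tcQ θ (d + 1) 0) (fun i t => Real.sin (θ (d + 2) - t) * tcQ θ' d i t) :
          Fin (d + 2) → ℝ → ℝ) := by
      ext i t
      refine Fin.cases ?_ (fun i => ?_) i
      · simp
      · simp only [Fin.cons_succ, Fin.val_succ]
        have hi := i.2
        unfold tcQ
        rw [tc_prod_remove _ d (d - i) (by omega)]
        congr 1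
        · congr 3; omega
        · refine Finset.prod_congr rfl fun j hj => ?_
          simp only [θ']
          split_ifs
          · congr 3; omega
          · omega
          · omega
          · congr 3; omega
    have h2 := tc_det_cons (θ (d + 2)) s' (tcQ θ (d + 1) 0)
      (fun t => Real.sin (θ (d + 2) - t)) (by simp) (fun i => tcQ θ' d i)
    rw [← hE, hL] at h2
    rw [tc_vand_cons] at hs'
    have hprod := left_ne_zero_of_mul hs'
    have hv := right_ne_zero_of_mul hs'
    have h3 : tcQ θ (d + 1) 0 (θ (d + 2)) *
        ((∏ j, Real.sin (θ (d + 2) - s' j)) *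
          (Matrix.of fun j (i : Fin (d + 1)) => tcQ θ' d i (s' j)).det) ≠ 0 := by
      refine mul_ne_zero ?_ (mul_ne_zero ?_ (IH s' hv))
      · unfold tcQ
        refine Finset.prod_ne_zero_iff.2 fun j hj => ?_
        have hj := Finset.mem_range.1 hj
        rw [← neg_sub, Real.sin_neg]
        exact neg_ne_zero.2 (hθ _ _ (by omega) (by omega))
      · rw [Finset.prod_ne_zero_iff] at hprod ⊢
        intro j hj
        rw [← neg_sub, Real.sin_neg]
        exact neg_ne_zero.2 (hprod j hj)
    rw [← h2] at h3
    exact left_ne_zero_of_mul h3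

theorem tc_vand_pos {k : ℕ} (s : Fin k → ℝ) (h0 : ∀ j, 0 ≤ s j) (hs : StrictMono s)
    (hpi : ∀ j, s j < Real.pi) : 0 < tcVand s := by
  unfold tcVand
  refine Finset.prod_pos fun i _ => Finset.prod_pos fun j hj => ?_
  have := hs (Finset.mem_Ioi.1 hj)
  exact Real.sin_pos_of_pos_of_lt_pi (by linarith) (by linarith [h0 i, hpi j])

/-- The boundary measurement formula for the top cell `f = f_{k,n}`
(Theorem 1.9 combined with Proposition 4.4): for a generic `f_{k,n}`-admissible
tuple `θ`, the curve `γ_θ(t)_r = Π_{j=1}^{k−1} sin(t − θ̃_{r+j})` spans a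
`k`-dimensional subspace of `ℝⁿ`; evaluation at any `0 ≤ s_1 < ⋯ < s_k < π`
yields a basis, and the ratio of any two nonzero maximal minors of the
corresponding `k × n` matrix is positive (so the span is a point of `Gr_{≥0}(k,n)`).
Here `θ̃ : ℤ → ℝ` is the extension of `θ ∈ ℝⁿ` with `θ̃_{p+n} = θ̃_p + π`, the
coordinates of `ℝⁿ` are indexed by `Fin n` via `r ↦ r+1 ∈ [n]`, genericity means
`θ_p ≢ θ_q (mod π)` for `p ≠ q` in `[n]`, and `f_{k,n}`-admissibility means
`θ̃_p < θ̃_q < θ̃_p + π` for all integers `p < q` with `q − p ≤ min(k−1, n−k)`. -/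
theorem top_cell_boundary_measurement (k n : ℕ) (hk : 1 ≤ k) (hkn : k ≤ n)
    (θt : ℤ → ℝ) (hper : ∀ p : ℤ, θt (p + n) = θt p + Real.pi)
    (hgen : ∀ p q : Fin n, p ≠ q →
      ¬ ∃ m : ℤ, θt ((p : ℤ) + 1) - θt ((q : ℤ) + 1) = m * Real.pi)
    (hadm : ∀ p q : ℤ, p < q → q - p ≤ min ((k : ℤ) - 1) ((n : ℤ) - (k : ℤ)) →
      θt p < θt q ∧ θt q < θt p + Real.pi)
    (γ : ℝ → Fin n → ℝ)
    (hγ : ∀ t : ℝ, ∀ r : Fin n,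
      γ t r = ∏ j ∈ Finset.Icc 1 (k - 1), Real.sin (t - θt ((r : ℤ) + 1 + (j : ℤ)))) :
    Module.finrank ℝ ↥(Submodule.span ℝ (Set.range γ)) = k ∧
    ∀ s : Fin k → ℝ, (∀ j, 0 ≤ s j) → StrictMono s → (∀ j, s j < Real.pi) →
      (Submodule.span ℝ (Set.range fun j => γ (s j)) =
          Submodule.span ℝ (Set.range γ) ∧
       LinearIndependent ℝ (fun j => γ (s j)) ∧
       ∀ g g' : Fin k → Fin n, StrictMono g → StrictMono g' →
         (Matrix.of fun j i => γ (s j) (g i)).det ≠ 0 →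
         (Matrix.of fun j i => γ (s j) (g' i)).det ≠ 0 →
         0 < (Matrix.of fun j i => γ (s j) (g i)).det *
             (Matrix.of fun j i => γ (s j) (g' i)).det) := by
  obtain ⟨d, rfl⟩ : ∃ d, k = d + 1 := ⟨k - 1, by omega⟩
  let θ : ℕ → ℝ := fun p => θt ((p : ℤ) + 1)
  have hperm : ∀ (m : ℕ) (p : ℤ), θt (p + m * n) = θt p + m * Real.pi := by
    intro m
    induction m with
    | zero => intro p; simp
    | succ m ih =>
      intro p
      have : p + ((m + 1 : ℕ) : ℤ) * n = (p + m * n) + n := by push_cast; ring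
      rw [this, hper, ih]; push_cast; ring
  have hγQ : ∀ t r, γ t r = (-1) ^ d * tcQ θ d r t := by
    intro t r
    rw [hγ, Nat.add_sub_cancel]
    have h1 : Finset.Icc 1 d = Finset.Ico 1 (d + 1) := by ext; simp
    rw [h1, Finset.prod_Ico_eq_prod_range, Nat.add_sub_cancel]
    unfold tcQ
    have h2 : ((-1 : ℝ)) ^ d = ∏ j ∈ Finset.range d, (-1 : ℝ) := by simp
    rw [h2, ← Finset.prod_mul_distrib]
    refine Finset.prod_congr rfl fun j _ => ?_
    rw [neg_one_mul, ← Real.sin_neg, neg_sub]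
    simp only [θ]
    congr 3
    push_cast; ring
  have hsin : ∀ a b, a < b → b ≤ a + d → Real.sin (θ b - θ a) ≠ 0 := by
    intro a b hab hb h
    have hn : 0 < n := by omega
    obtain ⟨m, hm⟩ := Real.sin_eq_zero_iff.1 h
    have hred : ∀ p : ℕ, θ p = θt (((p % n : ℕ) : ℤ) + 1) + ((p / n : ℕ) : ℝ) * Real.pi := by
      intro p
      rw [← hperm]
      simp only [θ]
      congr 1
      have := Nat.mod_add_div p n
      have h' : (p : ℤ) = ((p % n : ℕ) : ℤ) + (n : ℤ) * ((p / n : ℕ) : ℤ) := by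
        exact_mod_cast this.symm
      linear_combination h'
    have hne : (⟨b % n, Nat.mod_lt _ hn⟩ : Fin n) ≠ ⟨a % n, Nat.mod_lt _ hn⟩ := by
      intro he
      have he := congrArg Fin.val he
      simp only at he
      have hd : n ∣ b - a := (Nat.modEq_iff_dvd' hab.le).1 (Eq.symm he)
      have := Nat.le_of_dvd (by omega) hd
      omega
    refine hgen _ _ hne ⟨m - ((b / n : ℕ) : ℤ) + ((a / n : ℕ) : ℤ), ?_⟩
    have ea := hred a
    have eb := hred b
    rw [Int.cast_add, Int.cast_sub, Int.cast_natCast, Int.cast_natCast]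
    linear_combination -eb + ea - hm
  have hcoef : ∀ r : Fin n, ∃ a : Fin (d + 1) → ℝ, ∑ l, a l • tcMon d l = tcQ θ d r := fun r =>
    (Submodule.mem_span_range_iff_exists_fun ℝ).1 (tc_Q_form θ d r)
  choose a ha using hcoef
  have hle : Module.finrank ℝ ↥(Submodule.span ℝ (Set.range γ)) ≤ d + 1 := by
    let A : Fin (d + 1) → Fin n → ℝ := fun l r => a r l
    have h1 : Submodule.span ℝ (Set.range γ) ≤ Submodule.span ℝ (Set.range A) := by
      rw [Submodule.span_le]
      rintro _ ⟨t, rfl⟩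
      refine (Submodule.mem_span_range_iff_exists_fun ℝ).2 ⟨fun l => (-1) ^ d * tcMon d l t, ?_⟩
      ext r
      rw [hγQ, ← ha r]
      simp only [Finset.sum_apply, Pi.smul_apply, smul_eq_mul, Finset.mul_sum, A]
      refine Finset.sum_congr rfl fun l _ => ?_
      ring
    calc _ ≤ Module.finrank ℝ ↥(Submodule.span ℝ (Set.range A)) := Submodule.finrank_mono h1
      _ ≤ Fintype.card (Fin (d + 1)) := finrank_range_le_card A
      _ = d + 1 := by simp
  have hLI : ∀ s : Fin (d + 1) → ℝ, tcVand s ≠ 0 → LinearIndependent ℝ (fun j => γ (s j)) := by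
    intro s hs
    have h1 := tc_det_ne_zero d θ hsin s hs
    have h2 : (Matrix.of fun j (i : Fin (d + 1)) => γ (s j) (Fin.castLE hkn i)).det ≠ 0 := by
      have : (Matrix.of fun j (i : Fin (d + 1)) => γ (s j) (Fin.castLE hkn i)) =
          ((-1 : ℝ) ^ d) • (Matrix.of fun j (i : Fin (d + 1)) => tcQ θ d i (s j)) := by
        ext j i
        simp [hγQ]
      rw [this, Matrix.det_smul]
      exact mul_ne_zero (by positivity) h1
    have h3 := Matrix.linearIndependent_rows_of_det_ne_zero h2
    refine LinearIndependent.of_comp (LinearMap.funLeft ℝ ℝ (Fin.castLE hkn)) ?_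
    exact h3
  have hfin : ∀ s : Fin (d + 1) → ℝ, tcVand s ≠ 0 →
      Module.finrank ℝ ↥(Submodule.span ℝ (Set.range fun j => γ (s j))) = d + 1 := by
    intro s hs
    rw [finrank_span_eq_card (hLI s hs)]; simp
  have hsub : ∀ s : Fin (d + 1) → ℝ, Submodule.span ℝ (Set.range fun j => γ (s j)) ≤
      Submodule.span ℝ (Set.range γ) := by
    intro s
    apply Submodule.span_mono
    rintro _ ⟨j, rfl⟩
    exact ⟨_, rfl⟩
  have hrank : Module.finrank ℝ ↥(Submodule.span ℝ (Set.range γ)) = d + 1 := by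
    obtain ⟨s', hs'⟩ := tc_exists_s d 0
    refine le_antisymm hle ?_
    rw [← hfin _ hs']
    exact Submodule.finrank_mono (hsub _)
  refine ⟨hrank, fun s h0 hs hpi => ?_⟩
  have hv := tc_vand_pos s h0 hs hpi
  refine ⟨Submodule.eq_of_le_of_finrank_eq (hsub s) ?_, hLI s hv.ne', ?_⟩
  · rw [hfin s hv.ne', hrank]
  intro g g' hg hg' hd hd'
  by_cases hkn' : d + 1 = n
  · subst hkn'
    have e1 : g = id := hg.eq_id
    have e2 : g' = id := hg'.eq_id
    subst e1; subst e2
    exact mul_self_pos.2 hd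
  · have hT : tcTNN (d + 1) n (tcQ θ d) := by
      rcases Nat.eq_zero_or_pos d with rfl | hd0
      · exact tc_TNN_zero θ n
      · refine tc_TNN_main d n θ hkn (strictMono_nat_of_lt_succ fun p => ?_) fun p => ?_
        · refine (hadm _ _ (by push_cast; omega) ?_).1
          push_cast
          rw [le_min_iff]
          constructor <;> omega
        · simp only [θ]
          rw [← hper]
          congr 1; push_cast; ring
    have hdet : ∀ g : Fin (d + 1) → Fin n, (Matrix.of fun j i => γ (s j) (g i)).det =
        ((-1 : ℝ) ^ d) ^ (d + 1) * (Matrix.of fun j i => tcQ θ d (g i) (s j)).det := by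
      intro g
      have : (Matrix.of fun j i => γ (s j) (g i)) =
          ((-1 : ℝ) ^ d) • (Matrix.of fun j i => tcQ θ d (g i) (s j)) := by
        ext j i
        simp [hγQ]
      rw [this, Matrix.det_smul]; simp
    have hnn : ∀ g : Fin (d + 1) → Fin n, StrictMono g →
        0 ≤ (Matrix.of fun j i => tcQ θ d (g i) (s j)).det := by
      intro g hg
      exact nonneg_of_mul_nonneg_left (hT (fun i => g i) hg (fun i => (g i).2) s) hv
    have hne := mul_ne_zero hd hd'
    refine lt_of_le_of_ne ?_ hne.symm
    rw [hdet, hdet]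
    have : ∀ e x y : ℝ, e * x * (e * y) = e * e * (x * y) := by intros; ring
    rw [this]
    exact mul_nonneg (mul_self_nonneg _) (mul_nonneg (hnn g hg) (hnn g' hg'))
end

section
/- Let 2 ≤ k ≤ n−1. Suppose θ, θ' ∈ ℝⁿ are both f_{k,n}-admissible with θ_1 = θ'_1 = 0. Define the top-cell boundary measurement curves γ_θ, γ_{θ'} : ℝ → ℝⁿ by (γ_θ(t))_r = Π_{j=1}^{k−1} sin(t − θ̃_{r+j}) for r ∈ [n], and similarly for θ'. If the ℝ-linear span of {γ_θ(t) : t ∈ ℝ} equals the ℝ-linear span of {γ_{θ'}(t) : t ∈ ℝ}, then θ = θ'. (This is the injectivity part of Theorem 1.7 for the top cell, expressed via the boundary measurement formula; note that for 2 ≤ k ≤ n−1 every f_{k,n}-admissible tuple is automatically generic.) -/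
/-- window product -/
noncomputable def winG (x : ℤ → ℝ) (w : ℕ) (a : ℤ) : ℝ → ℝ :=
  fun t => ∏ j ∈ Finset.range w, Real.sin (t - x (a + (j : ℤ)))

lemma three_term (A B z t : ℝ) :
    Real.sin (B - A) * Real.sin (t - z)
      = Real.sin (B - z) * Real.sin (t - A) + Real.sin (z - A) * Real.sin (t - B) := by
  simp only [Real.sin_sub]
  have hA := Real.sin_sq_add_cos_sq A
  have hB := Real.sin_sq_add_cos_sq B
  ring_nf

lemma winG_left (x : ℤ → ℝ) (w : ℕ) (a : ℤ) (t : ℝ) :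
    winG x (w + 1) a t = Real.sin (t - x a) * winG x w (a + 1) t := by
  unfold winG
  rw [Finset.prod_range_succ']
  rw [mul_comm]
  congr 1
  · simp
  · refine Finset.prod_congr rfl fun j _ => ?_
    congr 3
    push_cast
    ring

lemma winG_right (x : ℤ → ℝ) (w : ℕ) (a : ℤ) (t : ℝ) :
    winG x (w + 1) a t = winG x w a t * Real.sin (t - x (a + w)) := by
  unfold winG
  rw [Finset.prod_range_succ]

lemma span_lem (n : ℕ) (x : ℤ → ℝ)
    (hne : ∀ a b : ℤ, a < b → b - a < n → Real.sin (x b - x a) ≠ 0) (p : ℤ) :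
    ∀ m : ℕ, m + 1 < n → ∀ L : (ℝ → ℝ) →ₗ[ℝ] ℝ,
      (∀ a : ℤ, p - m ≤ a → a ≤ p → L (winG x (m + 1) a) = 0) →
      ∀ z : ℕ → ℝ, L (fun t => Real.sin (t - x p) * ∏ i ∈ Finset.range m, Real.sin (t - z i)) = 0 := by
  intro m
  induction m with
  | zero =>
    intro _ L h z
    have := h p (by simp) le_rfl
    convert this using 2
    funext t
    simp [winG]
  | succ m ih =>
    intro hm L h z
    have key := ih (by omega) (L.comp (LinearMap.mulLeft ℝ (fun t => Real.sin (t - z m)))) ?_ z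
    · rw [LinearMap.comp_apply] at key
      convert key using 2
      funext t
      simp only [LinearMap.mulLeft_apply, Pi.mul_apply, Finset.prod_range_succ]
      ring
    · intro b hb1 hb2
      have e1 := h (b - 1) (by push_cast; omega) (by omega)
      have e2 := h b (by push_cast; omega) hb2
      have hs := hne (b - 1) (b + m + 1) (by omega) (by omega)
      set A := x (b - 1) with hA
      set B := x (b + m + 1) with hB
      have : Real.sin (B - A) • (LinearMap.mulLeft ℝ (fun t => Real.sin (t - z m))) (winG x (m + 1) b)
          = Real.sin (B - z m) • winG x (m + 1 + 1) (b - 1)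
            + Real.sin (z m - A) • winG x (m + 1 + 1) b := by
        funext t
        simp only [LinearMap.mulLeft_apply, Pi.mul_apply, Pi.add_apply, Pi.smul_apply, smul_eq_mul]
        rw [winG_left x (m + 1) (b - 1), winG_right x (m + 1) b]
        rw [show b - 1 + 1 = b by ring, show b + ((m + 1 : ℕ) : ℤ) = b + m + 1 by push_cast; ring]
        rw [← hA, ← hB]
        linear_combination (winG x (m + 1) b t) * three_term A B (z m) t
      have h2 := congrArg L this
      rw [map_smul, map_add, map_smul, map_smul, e1, e2] at h2
      simp only [smul_eq_mul, mul_zero, add_zero, mul_eq_zero] at h2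
      rw [LinearMap.comp_apply]
      exact h2.resolve_left hs

lemma winG_per (n : ℕ) (x : ℤ → ℝ) (hper : ∀ p : ℤ, x (p + n) = x p + Real.pi)
    (w : ℕ) (a : ℤ) (t : ℝ) : winG x w (a + n) t = (-1) ^ w * winG x w a t := by
  induction w with
  | zero => simp [winG]
  | succ w ih =>
    rw [winG_right, winG_right, ih, show a + (n : ℤ) + w = a + w + n by ring, hper,
      show t - (x (a + w) + Real.pi) = t - x (a + w) - Real.pi by ring, Real.sin_sub_pi]
    ring

/-- the local relation -/
lemma rel_lem (n l : ℕ) (hl : 1 ≤ l) (hln : l + 2 ≤ n) (x y : ℤ → ℝ)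
    (hx : ∀ p : ℤ, x (p + n) = x p + Real.pi) (hy : ∀ p : ℤ, y (p + n) = y p + Real.pi)
    (hnx : ∀ a b : ℤ, a < b → b - a < n → Real.sin (x b - x a) ≠ 0)
    (hny : ∀ a b : ℤ, a < b → b - a < n → Real.sin (y b - y a) ≠ 0)
    (p : ℤ) (L : (ℝ → ℝ) →ₗ[ℝ] ℝ) (hL : ∀ r : ℤ, L (winG y l r) = winG x l r (x p))
    (Q : ℤ) (h1 : Q < p) (h2 : p < Q + n - l) :
    Real.sin (x p - x Q) * Real.sin (y (Q + n - l) - y p)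
      = Real.sin (x (Q + n - l) - x p) * Real.sin (y p - y Q) := by
  obtain ⟨m, rfl⟩ : ∃ m, l = m + 1 := ⟨l - 1, by omega⟩
  have hz : ∀ a : ℤ, p - m ≤ a → a ≤ p → L (winG y (m + 1) a) = 0 := by
    intro a ha1 ha2
    rw [hL]
    unfold winG
    refine Finset.prod_eq_zero (i := (p - a).toNat) (by simp; omega) ?_
    rw [show a + ((p - a).toNat : ℤ) = p by omega]
    simp
  -- r = Q - l
  set r : ℤ := Q - (m + 1) with hr
  have kill := span_lem n y hny p m (by omega) L hz (fun i => y (r + 1 + i))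
  have e1 : winG x (m + 1) r (x p) = Real.sin (x p - x r) * winG x m (r + 1) (x p) := winG_left ..
  have e2 : winG x (m + 1) (r + 1) (x p) = winG x m (r + 1) (x p) * Real.sin (x p - x Q) := by
    rw [winG_right, show r + 1 + (m : ℤ) = Q by rw [hr]; ring]
  have hC : winG x m (r + 1) (x p) ≠ 0 := by
    unfold winG
    refine Finset.prod_ne_zero_iff.2 fun j hj => hnx _ _ ?_ ?_
    · have := Finset.mem_range.1 hj
      omega
    · push_cast at h2
      omega
  have fe : Real.sin (y p - y Q) • winG y (m + 1) r - Real.sin (y p - y r) • winG y (m + 1) (r + 1)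
      = Real.sin (y r - y Q) • (fun t => Real.sin (t - y p) *
        ∏ i ∈ Finset.range m, Real.sin (t - y (r + 1 + i))) := by
    funext t
    simp only [Pi.sub_apply, Pi.smul_apply, smul_eq_mul]
    rw [winG_left, winG_right, show r + 1 + (m : ℤ) = Q by rw [hr]; ring]
    have := three_term (y Q) (y r) (y p) t
    have h3 : Real.sin (y r - y p) = - Real.sin (y p - y r) := by rw [← Real.sin_neg]; ring_nf
    rw [h3] at this
    change _ = _ * (_ * winG y m (r + 1) t)
    linear_combination (-winG y m (r + 1) t) * this
  have h3 := congrArg L fe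
  rw [map_sub, map_smul, map_smul, map_smul, kill, hL, hL, e1, e2] at h3
  simp only [smul_eq_mul, mul_zero] at h3
  have hxr : x (Q + n - (m + 1 : ℕ)) = x r + Real.pi := by
    rw [← hx, hr]; congr 1; push_cast; ring
  have hyr : y (Q + n - (m + 1 : ℕ)) = y r + Real.pi := by
    rw [← hy, hr]; congr 1; push_cast; ring
  rw [hxr, hyr, show x r + Real.pi - x p = Real.pi - (x p - x r) by ring,
    show y r + Real.pi - y p = Real.pi - (y p - y r) by ring, Real.sin_pi_sub, Real.sin_pi_sub]
  apply mul_left_cancel₀ hC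
  linear_combination -h3

/-- polygon lemma part -/
lemma poly_sub (d e : ℕ → ℝ) (c : ℝ) (s : Finset ℕ)
    (hde : ∀ i ∈ s, e i ≤ d i) (he : ∀ i ∈ s, 0 < e i) (he2 : ∀ i ∈ s, e i ≤ Real.pi / 2)
    (hs : ∀ i ∈ s, Real.sin (d i) = c * Real.sin (e i)) (hc : 1 ≤ c)
    (hsum : ∑ i ∈ s, d i ≤ Real.pi) :
    Real.sin (∑ i ∈ s, d i) ≤ c * Real.sin (∑ i ∈ s, e i) := by
  induction s using Finset.induction_on with
  | empty => simp
  | insert a s ha ih =>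
    rw [Finset.sum_insert ha] at hsum
    rw [Finset.sum_insert ha, Finset.sum_insert ha]
    have hA := hde a (by simp)
    have hB := he a (by simp)
    have hC := he2 a (by simp)
    have hD := hs a (by simp)
    have hsub : ∀ i ∈ s, i ∈ insert a s := fun i hi => Finset.mem_insert_of_mem hi
    have ih' := ih (fun i hi => hde i (hsub i hi)) (fun i hi => he i (hsub i hi))
      (fun i hi => he2 i (hsub i hi)) (fun i hi => hs i (hsub i hi)) (by linarith)
    have hle : ∑ i ∈ s, e i ≤ ∑ i ∈ s, d i := Finset.sum_le_sum fun i hi => hde i (hsub i hi)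
    have h0 : 0 ≤ ∑ i ∈ s, e i := Finset.sum_nonneg fun i hi => (he i (hsub i hi)).le
    set S := ∑ i ∈ s, d i
    set S' := ∑ i ∈ s, e i
    have c1 : Real.cos (d a) ≤ Real.cos (e a) :=
      Real.cos_le_cos_of_nonneg_of_le_pi hB.le (by linarith) hA
    have c2 : Real.cos S ≤ Real.cos S' :=
      Real.cos_le_cos_of_nonneg_of_le_pi h0 (by linarith) hle
    have c3 : 0 ≤ Real.cos (e a) := Real.cos_nonneg_of_mem_Icc ⟨by linarith, hC⟩
    have c4 : 0 ≤ Real.sin S := Real.sin_nonneg_of_nonneg_of_le_pi (by linarith) (by linarith)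
    have c5 : 0 ≤ Real.sin (d a) :=
      Real.sin_nonneg_of_nonneg_of_le_pi (by linarith) (by linarith)
    rw [Real.sin_add, Real.sin_add]
    have t1 := mul_le_mul_of_nonneg_left c1 c4
    have t2 := mul_le_mul_of_nonneg_right ih' c3
    have t3 := mul_le_mul_of_nonneg_left c2 c5
    rw [mul_add]
    rw [hD] at *
    nlinarith

lemma poly_one (n : ℕ) (hn : 3 ≤ n) (d e : ℕ → ℝ) (c : ℝ) (hc : 1 ≤ c)
    (hd : ∀ i, 0 < d i) (he : ∀ i, 0 < e i)
    (hds : ∑ i ∈ Finset.range n, d i = Real.pi) (hes : ∑ i ∈ Finset.range n, e i = Real.pi)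
    (hs : ∀ i, i < n → Real.sin (d i) = c * Real.sin (e i)) :
    ∀ i, i < n → d i = e i := by
  have hdle : ∀ i, i < n → d i ≤ Real.pi := fun i hi => by
    rw [← hds]; exact Finset.single_le_sum (fun j _ => (hd j).le) (Finset.mem_range.2 hi)
  have hele : ∀ i, i < n → e i ≤ Real.pi := fun i hi => by
    rw [← hes]; exact Finset.single_le_sum (fun j _ => (he j).le) (Finset.mem_range.2 hi)
  have hge : ∀ i, i < n → e i ≤ Real.pi / 2 → e i ≤ d i := by
    intro i hi h
    by_contra! hlt
    have h1 : Real.sin (d i) < Real.sin (e i) :=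
      Real.sin_lt_sin_of_lt_of_le_pi_div_two (by linarith [hd i, Real.pi_pos]) h hlt
    have h2 : 0 ≤ Real.sin (e i) := Real.sin_nonneg_of_nonneg_of_le_pi (he i).le (hele i hi)
    rw [hs i hi] at h1
    nlinarith
  by_cases hall : ∀ i, i < n → e i ≤ Real.pi / 2
  · intro i hi
    have := (Finset.sum_eq_sum_iff_of_le (s := Finset.range n) (f := e) (g := d)
      (fun i hi => hge i (Finset.mem_range.1 hi) (hall i (Finset.mem_range.1 hi)))).1
      (by rw [hds, hes])
    exact (this i (Finset.mem_range.2 hi)).symm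
  · push Not at hall
    obtain ⟨j, hj, hej⟩ := hall
    set s := (Finset.range n).erase j with hsdef
    have hjm : j ∈ Finset.range n := Finset.mem_range.2 hj
    have sd : d j + ∑ i ∈ s, d i = Real.pi := by rw [← hds]; exact Finset.add_sum_erase _ _ hjm
    have se : e j + ∑ i ∈ s, e i = Real.pi := by rw [← hes]; exact Finset.add_sum_erase _ _ hjm
    have hsm : ∀ i ∈ s, i < n := fun i hi => Finset.mem_range.1 (Finset.mem_of_mem_erase hi)
    have hsmall : ∀ i ∈ s, e i ≤ Real.pi / 2 := by
      intro i hi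
      have := Finset.single_le_sum (f := e) (fun j _ => (he j).le) hi
      linarith
    have hrest : ∀ i ∈ s, d i = e i := by
      intro i hi
      set u := s.erase i with hu
      have ud : d i + ∑ i ∈ u, d i = ∑ i ∈ s, d i := Finset.add_sum_erase _ _ hi
      have ue : e i + ∑ i ∈ u, e i = ∑ i ∈ s, e i := Finset.add_sum_erase _ _ hi
      have hus : ∀ k ∈ u, k ∈ s := fun k hk => Finset.mem_of_mem_erase hk
      have hune : u.Nonempty := by
        rw [← Finset.card_pos, hu, Finset.card_erase_of_mem hi, hsdef,
          Finset.card_erase_of_mem hjm, Finset.card_range]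
        omega
      have hupos : 0 < ∑ i ∈ u, e i := Finset.sum_pos (fun k _ => he k) hune
      have hule : ∑ i ∈ u, e i ≤ ∑ i ∈ u, d i :=
        Finset.sum_le_sum fun k hk => hge k (hsm k (hus k hk)) (hsmall k (hus k hk))
      have hsub := poly_sub d e c u (fun k hk => hge k (hsm k (hus k hk)) (hsmall k (hus k hk)))
        (fun k _ => he k) (fun k hk => hsmall k (hus k hk)) (fun k hk => hs k (hsm k (hus k hk))) hc
        (by linarith [hd j, hd i])
      have hfin : Real.sin (∑ i ∈ s, d i) = c * Real.sin (∑ i ∈ s, e i) := by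
        rw [show ∑ i ∈ s, d i = Real.pi - d j by linarith,
          show ∑ i ∈ s, e i = Real.pi - e j by linarith, Real.sin_pi_sub, Real.sin_pi_sub]
        exact hs j hj
      rw [← ud, ← ue] at hfin
      set S := ∑ i ∈ u, d i
      set S' := ∑ i ∈ u, e i
      have hA := hge i (hsm i hi) (hsmall i hi)
      have hD := hs i (hsm i hi)
      have c2 : Real.cos S ≤ Real.cos S' :=
        Real.cos_le_cos_of_nonneg_of_le_pi hupos.le (by linarith [hd j, hd i]) hule
      have c3 : 0 ≤ Real.cos (e i) :=
        Real.cos_nonneg_of_mem_Icc ⟨by linarith [he i], hsmall i hi⟩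
      have c4 : 0 < Real.sin S := Real.sin_pos_of_pos_of_lt_pi (by linarith) (by linarith [hd j, hd i])
      have c5 : 0 ≤ Real.sin (d i) :=
        Real.sin_nonneg_of_nonneg_of_le_pi (hd i).le (hdle i (hsm i hi))
      by_contra hne
      have hlt : e i < d i := lt_of_le_of_ne hA (Ne.symm hne)
      have c1 : Real.cos (d i) < Real.cos (e i) :=
        Real.cos_lt_cos_of_nonneg_of_le_pi (he i).le (hdle i (hsm i hi)) hlt
      rw [Real.sin_add, Real.sin_add] at hfin
      have t1 := mul_lt_mul_of_pos_left c1 c4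
      have t2 := mul_le_mul_of_nonneg_right hsub c3
      have t3 := mul_le_mul_of_nonneg_left c2 c5
      rw [hD] at t3 hfin
      nlinarith
    intro i hi
    by_cases hij : i = j
    · subst hij
      have : ∑ i ∈ s, d i = ∑ i ∈ s, e i := Finset.sum_congr rfl hrest
      linarith
    · exact hrest i (Finset.mem_erase.2 ⟨hij, Finset.mem_range.2 hi⟩)

lemma poly_lem (n : ℕ) (hn : 3 ≤ n) (d e : ℕ → ℝ) (c : ℝ) (hc : 0 < c)
    (hd : ∀ i, 0 < d i) (he : ∀ i, 0 < e i)
    (hds : ∑ i ∈ Finset.range n, d i = Real.pi) (hes : ∑ i ∈ Finset.range n, e i = Real.pi)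
    (hs : ∀ i, i < n → Real.sin (d i) = c * Real.sin (e i)) :
    ∀ i, i < n → d i = e i := by
  rcases le_total 1 c with h | h
  · exact poly_one n hn d e c h hd he hds hes hs
  · intro i hi
    refine (poly_one n hn e d c⁻¹ ((one_le_inv₀ hc).2 h) he hd hes hds ?_ i hi).symm
    intro i hi
    rw [hs i hi]
    field_simp

lemma det_lem (a b c d x1 x2 y1 y2 k1 k2 : ℝ)
    (h1 : a * Real.cos x1 + b * Real.sin x1 = k1 * Real.cos y1)
    (h1' : c * Real.cos x1 + d * Real.sin x1 = k1 * Real.sin y1)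
    (h2 : a * Real.cos x2 + b * Real.sin x2 = k2 * Real.cos y2)
    (h2' : c * Real.cos x2 + d * Real.sin x2 = k2 * Real.sin y2) :
    (a * d - b * c) * Real.sin (x2 - x1) = k1 * k2 * Real.sin (y2 - y1) := by
  rw [Real.sin_sub, Real.sin_sub]
  calc _ = (a * Real.cos x1 + b * Real.sin x1) * (c * Real.cos x2 + d * Real.sin x2)
        - (c * Real.cos x1 + d * Real.sin x1) * (a * Real.cos x2 + b * Real.sin x2) := by ring
    _ = _ := by rw [h1, h1', h2, h2']; ring

lemma base_lem (x1 x2 x3 y1 y2 y3 : ℝ) (hx12 : Real.sin (x2 - x1) ≠ 0)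
    (hx13 : Real.sin (x3 - x1) ≠ 0) (hx32 : Real.sin (x2 - x3) ≠ 0)
    (hy12 : Real.sin (y2 - y1) ≠ 0)
    (hy13 : Real.sin (y3 - y1) ≠ 0) (hy32 : Real.sin (y2 - y3) ≠ 0) :
    ∃ a b c d : ℝ, a * d - b * c ≠ 0 ∧
      (∃ k, a * Real.cos x1 + b * Real.sin x1 = k * Real.cos y1 ∧
        c * Real.cos x1 + d * Real.sin x1 = k * Real.sin y1) ∧
      (∃ k, a * Real.cos x2 + b * Real.sin x2 = k * Real.cos y2 ∧
        c * Real.cos x2 + d * Real.sin x2 = k * Real.sin y2) ∧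
      (∃ k, a * Real.cos x3 + b * Real.sin x3 = k * Real.cos y3 ∧
        c * Real.cos x3 + d * Real.sin x3 = k * Real.sin y3) := by
  obtain ⟨P, hP⟩ : ∃ P, P = Real.sin (y2 - y3) * Real.sin (x3 - x1) := ⟨_, rfl⟩
  obtain ⟨R, hR⟩ : ∃ R, R = Real.sin (y3 - y1) * Real.sin (x2 - x3) := ⟨_, rfl⟩
  have hP0 : P ≠ 0 := by rw [hP]; exact mul_ne_zero hy32 hx13
  have hR0 : R ≠ 0 := by rw [hR]; exact mul_ne_zero hy13 hx32
  obtain ⟨a, ha⟩ : ∃ a, a = P * Real.sin x2 * Real.cos y1 - R * Real.sin x1 * Real.cos y2 := ⟨_, rfl⟩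
  obtain ⟨b, hb⟩ : ∃ b, b = -P * Real.cos x2 * Real.cos y1 + R * Real.cos x1 * Real.cos y2 :=
    ⟨_, rfl⟩
  obtain ⟨c, hc⟩ : ∃ c, c = P * Real.sin x2 * Real.sin y1 - R * Real.sin x1 * Real.sin y2 := ⟨_, rfl⟩
  obtain ⟨d, hd⟩ : ∃ d, d = -P * Real.cos x2 * Real.sin y1 + R * Real.cos x1 * Real.sin y2 :=
    ⟨_, rfl⟩
  have e1 : a * Real.cos x1 + b * Real.sin x1 = (P * Real.sin (x2 - x1)) * Real.cos y1 := by
    rw [ha, hb, Real.sin_sub]; ring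
  have e1' : c * Real.cos x1 + d * Real.sin x1 = (P * Real.sin (x2 - x1)) * Real.sin y1 := by
    rw [hc, hd, Real.sin_sub]; ring
  have e2 : a * Real.cos x2 + b * Real.sin x2 = (R * Real.sin (x2 - x1)) * Real.cos y2 := by
    rw [ha, hb, Real.sin_sub]; ring
  have e2' : c * Real.cos x2 + d * Real.sin x2 = (R * Real.sin (x2 - x1)) * Real.sin y2 := by
    rw [hc, hd, Real.sin_sub]; ring
  have e3 : a * Real.cos x3 + b * Real.sin x3
      = (Real.sin (x2 - x3) * Real.sin (x3 - x1) * Real.sin (y2 - y1)) * Real.cos y3 := by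
    have : a * Real.cos x3 + b * Real.sin x3
        = P * Real.sin (x2 - x3) * Real.cos y1 + R * Real.sin (x3 - x1) * Real.cos y2 := by
      rw [ha, hb, Real.sin_sub x2, Real.sin_sub x3]; ring
    rw [this, hP, hR, Real.sin_sub y2, Real.sin_sub y3, Real.sin_sub y2]; ring
  have e3' : c * Real.cos x3 + d * Real.sin x3
      = (Real.sin (x2 - x3) * Real.sin (x3 - x1) * Real.sin (y2 - y1)) * Real.sin y3 := by
    have : c * Real.cos x3 + d * Real.sin x3
        = P * Real.sin (x2 - x3) * Real.sin y1 + R * Real.sin (x3 - x1) * Real.sin y2 := by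
      rw [hc, hd, Real.sin_sub x2, Real.sin_sub x3]; ring
    rw [this, hP, hR, Real.sin_sub y2, Real.sin_sub y3, Real.sin_sub y2]; ring
  refine ⟨a, b, c, d, ?_, ⟨_, e1, e1'⟩, ⟨_, e2, e2'⟩, ⟨_, e3, e3'⟩⟩
  intro h0
  have := det_lem a b c d x1 x2 y1 y2 _ _ e1 e1' e2 e2'
  rw [h0, zero_mul] at this
  exact (mul_ne_zero (mul_ne_zero (mul_ne_zero hP0 hx12) (mul_ne_zero hR0 hx12)) hy12) this.symm

lemma step_lem (a b c d x1 x2 x3 x4 y1 y2 y3 y4 : ℝ) (hD : a * d - b * c ≠ 0)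
    (hx13 : Real.sin (x3 - x1) ≠ 0) (hx23 : Real.sin (x3 - x2) ≠ 0)
    (hy12 : Real.sin (y2 - y1) ≠ 0)
    (hcr : Real.sin (x4 - x1) * Real.sin (x3 - x2) * Real.sin (y3 - y1) * Real.sin (y4 - y2)
      = Real.sin (x3 - x1) * Real.sin (x4 - x2) * Real.sin (y4 - y1) * Real.sin (y3 - y2))
    (h1 : ∃ k, a * Real.cos x1 + b * Real.sin x1 = k * Real.cos y1 ∧
        c * Real.cos x1 + d * Real.sin x1 = k * Real.sin y1)
    (h2 : ∃ k, a * Real.cos x2 + b * Real.sin x2 = k * Real.cos y2 ∧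
        c * Real.cos x2 + d * Real.sin x2 = k * Real.sin y2)
    (h3 : ∃ k, a * Real.cos x3 + b * Real.sin x3 = k * Real.cos y3 ∧
        c * Real.cos x3 + d * Real.sin x3 = k * Real.sin y3) :
    ∃ k, a * Real.cos x4 + b * Real.sin x4 = k * Real.cos y4 ∧
        c * Real.cos x4 + d * Real.sin x4 = k * Real.sin y4 := by
  obtain ⟨k1, e1, e1'⟩ := h1
  obtain ⟨k2, e2, e2'⟩ := h2
  obtain ⟨k3, e3, e3'⟩ := h3
  have d13 := det_lem _ _ _ _ _ _ _ _ _ _ e1 e1' e3 e3'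
  have d23 := det_lem _ _ _ _ _ _ _ _ _ _ e2 e2' e3 e3'
  have n13 := mul_ne_zero hD hx13
  have n23 := mul_ne_zero hD hx23
  rw [d13] at n13
  rw [d23] at n23
  have hk1 : k1 ≠ 0 := left_ne_zero_of_mul (left_ne_zero_of_mul n13)
  have hk3 : k3 ≠ 0 := right_ne_zero_of_mul (left_ne_zero_of_mul n13)
  have hk2 : k2 ≠ 0 := left_ne_zero_of_mul (left_ne_zero_of_mul n23)
  have hy13 := right_ne_zero_of_mul n13
  have hy23 := right_ne_zero_of_mul n23
  obtain ⟨w1, hw1⟩ : ∃ w, w = a * Real.cos x4 + b * Real.sin x4 := ⟨_, rfl⟩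
  obtain ⟨w2, hw2⟩ : ∃ w, w = c * Real.cos x4 + d * Real.sin x4 := ⟨_, rfl⟩
  have m1 : k1 * (Real.cos y1 * w2 - Real.sin y1 * w1) = (a * d - b * c) * Real.sin (x4 - x1) := by
    calc _ = (k1 * Real.cos y1) * w2 - (k1 * Real.sin y1) * w1 := by ring
      _ = _ := by rw [← e1, ← e1', hw1, hw2, Real.sin_sub]; ring
  have m2 : k2 * (Real.cos y2 * w2 - Real.sin y2 * w1) = (a * d - b * c) * Real.sin (x4 - x2) := by
    calc _ = (k2 * Real.cos y2) * w2 - (k2 * Real.sin y2) * w1 := by ring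
      _ = _ := by rw [← e2, ← e2', hw1, hw2, Real.sin_sub]; ring
  have m3 : Real.sin (y2 - y1) * (w1 * Real.sin y4 - w2 * Real.cos y4)
      = Real.sin (y4 - y2) * (Real.cos y1 * w2 - Real.sin y1 * w1)
        - Real.sin (y4 - y1) * (Real.cos y2 * w2 - Real.sin y2 * w1) := by
    simp only [Real.sin_sub]; ring
  have hzero : w1 * Real.sin y4 - w2 * Real.cos y4 = 0 := by
    have hK : k1 * k2 * k3 * Real.sin (y3 - y1) * Real.sin (y3 - y2) * Real.sin (y2 - y1) ≠ 0 := by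
      simp only [ne_eq, mul_eq_zero, not_or]
      tauto
    apply (mul_eq_zero.1 _).resolve_left hK
    calc _ = k1 * k2 * k3 * Real.sin (y3 - y1) * Real.sin (y3 - y2) *
          (Real.sin (y2 - y1) * (w1 * Real.sin y4 - w2 * Real.cos y4)) := by ring
      _ = (k2 * k3 * Real.sin (y3 - y2)) * Real.sin (y3 - y1) * Real.sin (y4 - y2) *
            (k1 * (Real.cos y1 * w2 - Real.sin y1 * w1))
          - (k1 * k3 * Real.sin (y3 - y1)) * Real.sin (y3 - y2) * Real.sin (y4 - y1) *
            (k2 * (Real.cos y2 * w2 - Real.sin y2 * w1)) := by rw [m3]; ring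
      _ = 0 := by
        rw [m1, m2, ← d13, ← d23]
        linear_combination (a * d - b * c) ^ 2 * hcr
  rw [← hw1, ← hw2]
  refine ⟨w1 * Real.cos y4 + w2 * Real.sin y4, ?_, ?_⟩
  · linear_combination Real.sin y4 * hzero - w1 * Real.sin_sq_add_cos_sq y4
  · linear_combination -Real.cos y4 * hzero - w2 * Real.sin_sq_add_cos_sq y4

lemma sin_pos_lem (n : ℕ) (X : ℕ → ℝ) (hX : StrictMono X)
    (hpX : ∀ i, X (i + n) = X i + Real.pi) (i j : ℕ) (h : i < j) (h2 : j < i + n) :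
    0 < Real.sin (X j - X i) := by
  apply Real.sin_pos_of_pos_of_lt_pi
  · linarith [hX h]
  · linarith [hX h2, hpX i]

lemma const_lem (n N : ℕ) (hn : 3 ≤ n) (hN : 2 ≤ N) (hNn : N < n) (X Y : ℕ → ℝ)
    (hX : StrictMono X) (hY : StrictMono Y)
    (hpX : ∀ i, X (i + n) = X i + Real.pi) (hpY : ∀ i, Y (i + n) = Y i + Real.pi)
    (hrel : ∀ Q p : ℕ, Q < p → p < Q + N →
      Real.sin (X p - X Q) * Real.sin (Y (Q + N) - Y p)
        = Real.sin (X (Q + N) - X p) * Real.sin (Y p - Y Q)) :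
    ∃ c : ℝ, 0 < c ∧ ∀ i, Real.sin (X (i + 1) - X i) = c * Real.sin (Y (i + 1) - Y i) := by
  have sX := sin_pos_lem n X hX hpX
  have sY := sin_pos_lem n Y hY hpY
  have nX : ∀ i j, i < j → j < i + n → Real.sin (X i - X j) ≠ 0 := fun i j h h2 => by
    rw [← neg_sub, Real.sin_neg]; exact neg_ne_zero.2 (sX i j h h2).ne'
  have nY : ∀ i j, i < j → j < i + n → Real.sin (Y i - Y j) ≠ 0 := fun i j h h2 => by
    rw [← neg_sub, Real.sin_neg]; exact neg_ne_zero.2 (sY i j h h2).ne'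
  rcases Nat.lt_or_ge N 3 with h3 | h3
  · obtain rfl : N = 2 := by omega
    have p0 := sX 0 1 (by omega) (by omega)
    have q0 := sY 0 1 (by omega) (by omega)
    refine ⟨Real.sin (X 1 - X 0) / Real.sin (Y 1 - Y 0), div_pos p0 q0, ?_⟩
    intro i
    induction i with
    | zero => simp only [zero_add]; field_simp
    | succ i ih =>
      have := hrel i (i + 1) (by omega) (by omega)
      have q1 := sY i (i + 1) (by omega) (by omega)
      rw [ih] at this
      apply mul_right_cancel₀ q1.ne'
      change Real.sin (X (i + 2) - X (i + 1)) * _ = _ * Real.sin (Y (i + 2) - Y (i + 1)) * _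
      linear_combination -this
  · obtain ⟨a, b, c, d, hD, g0, g1, gN⟩ := base_lem (X 0) (X 1) (X N) (Y 0) (Y 1) (Y N)
      (sX 0 1 (by omega) (by omega)).ne' (sX 0 N (by omega) (by omega)).ne'
      (nX 1 N (by omega) (by omega))
      (sY 0 1 (by omega) (by omega)).ne' (sY 0 N (by omega) (by omega)).ne'
      (nY 1 N (by omega) (by omega))
    have good : ∀ m, ∃ k, a * Real.cos (X m) + b * Real.sin (X m) = k * Real.cos (Y m) ∧
        c * Real.cos (X m) + d * Real.sin (X m) = k * Real.sin (Y m) := by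
      intro m
      induction m using Nat.strong_induction_on with
      | _ m ih =>
        rcases Nat.eq_zero_or_pos m with rfl | hm0
        · exact g0
        rcases eq_or_ne m 1 with rfl | hm1
        · exact g1
        rcases eq_or_ne m N with rfl | hmN
        · exact gN
        rcases lt_or_gt_of_ne hmN with hlt | hgt
        · refine step_lem a b c d (X 0) (X N) (X 1) (X m) (Y 0) (Y N) (Y 1) (Y m) hD
            (sX 0 1 (by omega) (by omega)).ne' (nX 1 N (by omega) (by omega))
            (sY 0 N (by omega) (by omega)).ne' ?_ g0 gN g1
          have r1 := hrel 0 1 (by omega) (by omega)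
          have r2 := hrel 0 m (by omega) (by omega)
          rw [zero_add] at r1 r2
          rw [← neg_sub (X N) (X 1), ← neg_sub (X N) (X m), ← neg_sub (Y N) (Y 1),
            ← neg_sub (Y N) (Y m)]
          simp only [Real.sin_neg]
          linear_combination (Real.sin (X N - X 1) * Real.sin (Y 1 - Y 0)) * r2
            - (Real.sin (X N - X m) * Real.sin (Y m - Y 0)) * r1
        · obtain ⟨q, rfl⟩ : ∃ q, m = q + N := ⟨m - N, by omega⟩
          refine step_lem a b c d (X (q + 1)) (X (q + 2)) (X q) (X (q + N))
            (Y (q + 1)) (Y (q + 2)) (Y q) (Y (q + N)) hD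
            (nX q (q + 1) (by omega) (by omega)) (nX q (q + 2) (by omega) (by omega))
            (sY (q + 1) (q + 2) (by omega) (by omega)).ne' ?_
            (ih _ (by omega)) (ih _ (by omega)) (ih _ (by omega))
          have r1 := hrel q (q + 1) (by omega) (by omega)
          have r2 := hrel q (q + 2) (by omega) (by omega)
          rw [← neg_sub (X (q + 1)) (X q), ← neg_sub (X (q + 2)) (X q),
            ← neg_sub (Y (q + 1)) (Y q), ← neg_sub (Y (q + 2)) (Y q)]
          simp only [Real.sin_neg]
          linear_combination (Real.sin (X (q + N) - X (q + 1)) * Real.sin (Y (q + 1) - Y q)) * r2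
            - (Real.sin (X (q + N) - X (q + 2)) * Real.sin (Y (q + 2) - Y q)) * r1
    choose k hk1 hk2 using good
    have det : ∀ i j, (a * d - b * c) * Real.sin (X j - X i) = k i * k j * Real.sin (Y j - Y i) :=
      fun i j => det_lem _ _ _ _ _ _ _ _ _ _ (hk1 i) (hk2 i) (hk1 j) (hk2 j)
    have hk0 : ∀ i, k i ≠ 0 := by
      intro i h
      have := det i (i + 1)
      rw [h, zero_mul, zero_mul] at this
      exact mul_ne_zero hD (sX i (i + 1) (by omega) (by omega)).ne' this
    have hkN : ∀ q, k (q + N) = k q := by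
      intro q
      have r := hrel q (q + 1) (by omega) (by omega)
      have d1 := det q (q + 1)
      have d2 := det (q + 1) (q + N)
      have s1 := (sY q (q + 1) (by omega) (by omega)).ne'
      have s2 := (sY (q + 1) (q + N) (by omega) (by omega)).ne'
      apply mul_left_cancel₀ (mul_ne_zero (mul_ne_zero (hk0 (q + 1)) s1) s2)
      linear_combination Real.sin (Y (q + N) - Y (q + 1)) * d1
        - Real.sin (Y (q + 1) - Y q) * d2 - (a * d - b * c) * r
    have hsq : ∀ i, k i ^ 2 = (a * Real.cos (X i) + b * Real.sin (X i)) ^ 2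
        + (c * Real.cos (X i) + d * Real.sin (X i)) ^ 2 := by
      intro i
      rw [hk1, hk2]
      linear_combination (-k i ^ 2) * Real.sin_sq_add_cos_sq (Y i)
    obtain ⟨U, hU⟩ : ∃ U, U = a ^ 2 + c ^ 2 - b ^ 2 - d ^ 2 := ⟨_, rfl⟩
    obtain ⟨V, hV⟩ : ∃ V, V = a * b + c * d := ⟨_, rfl⟩
    have hs : ∀ q, 2 * V * Real.cos (X q + X (q + N)) = U * Real.sin (X q + X (q + N)) := by
      intro q
      have h1 := hsq q
      have h2 := hsq (q + N)
      rw [hkN] at h2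
      have s1 := (sX q (q + N) (by omega) (by omega)).ne'
      apply mul_left_cancel₀ s1
      rw [Real.sin_sub, Real.cos_add, Real.sin_add, hU, hV]
      have t1 := Real.sin_sq_add_cos_sq (X q)
      have t2 := Real.sin_sq_add_cos_sq (X (q + N))
      have t1' : Real.sin (X q) ^ 2 = 1 - Real.cos (X q) ^ 2 := by linarith
      have t2' : Real.sin (X (q + N)) ^ 2 = 1 - Real.cos (X (q + N)) ^ 2 := by linarith
      have h3 := h1.symm.trans h2
      ring_nf at h3 ⊢
      simp only [t1', t2'] at h3 ⊢
      ring_nf at h3 ⊢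
      linear_combination -h3
    have hUV : U = 0 ∧ V = 0 := by
      by_contra hne
      have hnz : U ^ 2 + (2 * V) ^ 2 ≠ 0 := by
        intro h
        apply hne
        constructor <;> nlinarith [sq_nonneg U, sq_nonneg V]
      have hz : ∀ q, Real.sin ((X (q + 1) + X (q + 1 + N)) - (X q + X (q + N))) = 0 := by
        intro q
        rw [Real.sin_sub]
        have e1 := hs q
        have e2 := hs (q + 1)
        apply (mul_eq_zero.1 _).resolve_left hnz
        linear_combination (2 * V * Real.sin (X (q + 1) + X (q + 1 + N))
          + U * Real.cos (X (q + 1) + X (q + 1 + N))) * e1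
          - (2 * V * Real.sin (X q + X (q + N)) + U * Real.cos (X q + X (q + N))) * e2
      have hgap : ∀ q, Real.pi ≤ (X (q + 1) + X (q + 1 + N)) - (X q + X (q + N)) := by
        intro q
        by_contra! hlt
        have := hX (show q < q + 1 by omega)
        have := hX (show q + N < q + 1 + N by omega)
        exact (Real.sin_pos_of_pos_of_lt_pi (by linarith) hlt).ne' (hz q)
      have g0 := hgap 0
      have g1 := hgap 1
      have g2 := hgap 2
      norm_num only at g0 g1 g2
      have l1 : X 3 ≤ X (0 + n) := hX.monotone (by omega)
      have l2 : X (3 + N) ≤ X (0 + N + n) := hX.monotone (by omega)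
      rw [hpX] at l1 l2
      have := Real.pi_pos
      norm_num only at *
      linarith
    have hconst : ∀ i, k i ^ 2 = b ^ 2 + d ^ 2 := by
      intro i
      rw [hsq]
      obtain ⟨u, v⟩ := hUV
      rw [hU] at u
      rw [hV] at v
      linear_combination Real.cos (X i) ^ 2 * u + 2 * Real.sin (X i) * Real.cos (X i) * v
        + (b ^ 2 + d ^ 2) * Real.sin_sq_add_cos_sq (X i)
    have hpos : 0 < b ^ 2 + d ^ 2 := by
      rw [← hconst 0]; exact lt_of_le_of_ne (sq_nonneg _) (Ne.symm (pow_ne_zero 2 (hk0 0)))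
    refine ⟨(b ^ 2 + d ^ 2) / |a * d - b * c|, div_pos hpos (abs_pos.2 hD), ?_⟩
    intro i
    have e := congrArg abs (det i (i + 1))
    rw [abs_mul, abs_mul, abs_mul, abs_of_pos (sX i (i + 1) (by omega) (by omega)),
      abs_of_pos (sY i (i + 1) (by omega) (by omega))] at e
    have ek : |k i| * |k (i + 1)| = b ^ 2 + d ^ 2 := by
      have : |k i| = |k (i + 1)| := (sq_eq_sq_iff_abs_eq_abs _ _).1 ((hconst i).trans (hconst (i + 1)).symm)
      rw [this, ← sq, sq_abs, hconst]
    rw [ek] at e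
    have := (abs_pos.2 hD).ne'
    rw [div_mul_eq_mul_div, eq_div_iff this, mul_comm]
    exact e

lemma func_lem {n : ℕ} (g : ℝ → Fin n → ℝ) (v : Fin n → ℝ)
    (hv : v ∈ Submodule.span ℝ (Set.range g)) :
    ∃ L : (ℝ → ℝ) →ₗ[ℝ] ℝ, ∀ r, L (fun t => g t r) = v r := by
  induction hv using Submodule.span_induction with
  | mem w hw =>
    obtain ⟨t, rfl⟩ := hw
    exact ⟨LinearMap.proj t, fun r => rfl⟩
  | zero => exact ⟨0, fun r => rfl⟩
  | add u w _ _ hu hw =>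
    obtain ⟨L, hL⟩ := hu
    obtain ⟨M, hM⟩ := hw
    exact ⟨L + M, fun r => by simp [hL, hM]⟩
  | smul c u _ hu =>
    obtain ⟨L, hL⟩ := hu
    exact ⟨c • L, fun r => by simp [hL]⟩

lemma ext_per (n l : ℕ) (x y : ℤ → ℝ)
    (hx : ∀ p : ℤ, x (p + n) = x p + Real.pi) (hy : ∀ p : ℤ, y (p + n) = y p + Real.pi)
    (L : (ℝ → ℝ) →ₗ[ℝ] ℝ) (T : ℝ) (a : ℤ) :
    L (winG y l a) = winG x l a T ↔ L (winG y l (a + n)) = winG x l (a + n) T := by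
  have : winG y l (a + n) = ((-1 : ℝ) ^ l) • winG y l a := by
    funext t
    rw [winG_per n y hy]
    rfl
  rw [this, map_smul, winG_per n x hx, smul_eq_mul]
  have h : ((-1 : ℝ)) ^ l ≠ 0 := pow_ne_zero _ (by norm_num)
  exact ⟨fun h => by rw [h], fun e => mul_left_cancel₀ h e⟩

lemma ext_all (n l : ℕ) (hn : 0 < n) (x y : ℤ → ℝ)
    (hx : ∀ p : ℤ, x (p + n) = x p + Real.pi) (hy : ∀ p : ℤ, y (p + n) = y p + Real.pi)
    (L : (ℝ → ℝ) →ₗ[ℝ] ℝ) (T : ℝ)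
    (h : ∀ r : ℤ, 0 ≤ r → r < n → L (winG y l (r + 2)) = winG x l (r + 2) T) (a : ℤ) :
    L (winG y l a) = winG x l a T := by
  have key : ∀ (z : ℤ) (r : ℤ), 0 ≤ r → r < n →
      L (winG y l (r + 2 + z * n)) = winG x l (r + 2 + z * n) T := by
    intro z r h0 h1
    induction z using Int.induction_on with
    | zero => simpa using h r h0 h1
    | succ i ih =>
      have := (ext_per n l x y hx hy L T _).1 ih
      rwa [show r + 2 + ((i : ℤ) + 1) * n = r + 2 + i * n + n by ring]
    | pred i ih =>
      apply (ext_per n l x y hx hy L T _).2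
      rwa [show r + 2 + (-(i : ℤ) - 1) * n + n = r + 2 + -i * n by ring]
  have hn' : (0 : ℤ) < n := by exact_mod_cast hn
  have := key ((a - 2) / n) ((a - 2) % n) (Int.emod_nonneg _ hn'.ne') (Int.emod_lt_of_pos _ hn')
  rwa [show (a - 2) % n + 2 + (a - 2) / n * n = a by
    have := Int.emod_add_mul_ediv (a - 2) n
    linarith] at this

lemma adm_mono (k n : ℕ) (hk : 2 ≤ k) (hkn : k + 1 ≤ n) (x : ℤ → ℝ)
    (hadm : ∀ p q : ℤ, p < q → q - p ≤ min ((k : ℤ) - 1) ((n : ℤ) - (k : ℤ)) →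
      x p < x q ∧ x q < x p + Real.pi) : StrictMono x := by
  apply strictMono_int_of_lt_succ
  intro a
  exact (hadm a (a + 1) (by omega) (by omega)).1

lemma sin_ne (n : ℕ) (x : ℤ → ℝ) (hm : StrictMono x)
    (hx : ∀ p : ℤ, x (p + n) = x p + Real.pi) (a b : ℤ) (h : a < b) (h2 : b - a < n) :
    Real.sin (x b - x a) ≠ 0 := by
  apply ne_of_gt
  apply Real.sin_pos_of_pos_of_lt_pi
  · linarith [hm h]
  · have := hm (show b < a + n by omega)
    rw [hx] at this
    linarith

lemma prod_win (x : ℤ → ℝ) (k : ℕ) (t : ℝ) (r : ℤ) :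
    ∏ j ∈ Finset.Icc 1 (k - 1), Real.sin (t - x (r + 1 + (j : ℤ))) = winG x (k - 1) (r + 2) t := by
  unfold winG
  rw [← Finset.Ico_succ_right_eq_Icc, Finset.prod_Ico_eq_prod_range]
  refine Finset.prod_congr (by simp) fun j _ => ?_
  congr 3
  push_cast
  ring

/-- Injectivity for the top cell (Theorem 1.7 via the boundary measurement
formula): for `2 ≤ k ≤ n−1`, two `f_{k,n}`-admissible tuples `θ, θ'` with
`θ_1 = θ'_1 = 0` whose boundary measurement curves span the same subspace of
`ℝⁿ` must be equal.  Here `θ̃ : ℤ → ℝ` extends `θ ∈ ℝⁿ` by `θ̃_{p+n} = θ̃_p + π`,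
coordinates of `ℝⁿ` are indexed by `Fin n` via `r ↦ r+1 ∈ [n]`, and
`f_{k,n}`-admissibility means `θ̃_p < θ̃_q < θ̃_p + π` for all integers `p < q`
with `q − p ≤ min(k−1, n−k)`. -/
theorem top_cell_injectivity (k n : ℕ) (hk : 2 ≤ k) (hkn : k + 1 ≤ n)
    (θt θt' : ℤ → ℝ)
    (hper : ∀ p : ℤ, θt (p + n) = θt p + Real.pi)
    (hper' : ∀ p : ℤ, θt' (p + n) = θt' p + Real.pi)
    (h1 : θt 1 = 0) (h1' : θt' 1 = 0)
    (hadm : ∀ p q : ℤ, p < q → q - p ≤ min ((k : ℤ) - 1) ((n : ℤ) - (k : ℤ)) →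
      θt p < θt q ∧ θt q < θt p + Real.pi)
    (hadm' : ∀ p q : ℤ, p < q → q - p ≤ min ((k : ℤ) - 1) ((n : ℤ) - (k : ℤ)) →
      θt' p < θt' q ∧ θt' q < θt' p + Real.pi)
    (γ γ' : ℝ → Fin n → ℝ)
    (hγ : ∀ t : ℝ, ∀ r : Fin n,
      γ t r = ∏ j ∈ Finset.Icc 1 (k - 1), Real.sin (t - θt ((r : ℤ) + 1 + (j : ℤ))))
    (hγ' : ∀ t : ℝ, ∀ r : Fin n,
      γ' t r = ∏ j ∈ Finset.Icc 1 (k - 1), Real.sin (t - θt' ((r : ℤ) + 1 + (j : ℤ))))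
    (hspan : Submodule.span ℝ (Set.range γ) = Submodule.span ℝ (Set.range γ')) :
    ∀ p : ℤ, 1 ≤ p → p ≤ n → θt p = θt' p := by
  have mx := adm_mono k n hk hkn θt hadm
  have my := adm_mono k n hk hkn θt' hadm'
  have nx := sin_ne n θt mx hper
  have ny := sin_ne n θt' my hper'
  have rel : ∀ p Q : ℤ, Q < p → p < Q + n - (k - 1 : ℕ) →
      Real.sin (θt p - θt Q) * Real.sin (θt' (Q + n - (k - 1 : ℕ)) - θt' p)
        = Real.sin (θt (Q + n - (k - 1 : ℕ)) - θt p) * Real.sin (θt' p - θt' Q) := by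
    intro p Q hQ1 hQ2
    have hmem : γ (θt p) ∈ Submodule.span ℝ (Set.range γ') := by
      rw [← hspan]; exact Submodule.subset_span ⟨_, rfl⟩
    obtain ⟨L, hL⟩ := func_lem γ' _ hmem
    refine rel_lem n (k - 1) (by omega) (by omega) θt θt' hper hper' nx ny p L ?_ Q hQ1 hQ2
    refine ext_all n (k - 1) (by omega) θt θt' hper hper' L _ ?_
    intro r h0 hr
    obtain ⟨m, rfl⟩ := Int.eq_ofNat_of_zero_le h0
    have := hL ⟨m, by omega⟩
    rw [hγ, prod_win] at this
    convert this using 2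
    funext t
    rw [hγ', prod_win]
  have eX : ∀ i : ℕ, θt (((i + n : ℕ) : ℤ) + 1) = θt ((i : ℤ) + 1) + Real.pi := by
    intro i; rw [← hper]; congr 1; push_cast; ring
  have eY : ∀ i : ℕ, θt' (((i + n : ℕ) : ℤ) + 1) = θt' ((i : ℤ) + 1) + Real.pi := by
    intro i; rw [← hper']; congr 1; push_cast; ring
  obtain ⟨c, hc, hcs⟩ := const_lem n (n - (k - 1)) (by omega) (by omega) (by omega)
    (fun i => θt ((i : ℤ) + 1)) (fun i => θt' ((i : ℤ) + 1))
    (fun i j h => mx (by omega)) (fun i j h => my (by omega)) eX eY (by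
      intro Q p h h2
      have := rel (p + 1) (Q + 1) (by omega) (by omega)
      have e : ((Q + (n - (k - 1)) : ℕ) : ℤ) + 1 = (Q : ℤ) + 1 + n - (k - 1 : ℕ) := by omega
      simp only [e]
      exact this)
  have sums : ∀ x : ℤ → ℝ, (∀ p : ℤ, x (p + n) = x p + Real.pi) →
      ∑ i ∈ Finset.range n, (x (((i + 1 : ℕ) : ℤ) + 1) - x ((i : ℤ) + 1)) = Real.pi := by
    intro x hx
    rw [Finset.sum_range_sub (fun i : ℕ => x ((i : ℤ) + 1))]
    have := hx 1
    rw [add_comm] at this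
    simp only [this]
    simp
  have fin := poly_lem n (by omega)
    (fun i => θt (((i + 1 : ℕ) : ℤ) + 1) - θt ((i : ℤ) + 1))
    (fun i => θt' (((i + 1 : ℕ) : ℤ) + 1) - θt' ((i : ℤ) + 1)) c hc
    (fun i => sub_pos.2 (mx (by omega))) (fun i => sub_pos.2 (my (by omega)))
    (sums θt hper) (sums θt' hper') (fun i _ => hcs i)
  have all : ∀ m : ℕ, m < n → θt ((m : ℤ) + 1) = θt' ((m : ℤ) + 1) := by
    intro m
    induction m with
    | zero => intro _; simp [h1, h1']
    | succ m ih =>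
      intro hm
      have a1 := ih (by omega)
      have a2 := fin m (by omega)
      linarith
  intro p hp1 hp2
  have := all (p - 1).toNat (by omega)
  rwa [show ((p - 1).toNat : ℤ) + 1 = p by omega] at this
end
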